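/- arXiv:1001.2651 — 3 statements merged into one kernel-verified Lean document; each statement's English description precedes it below -/
import Mathlib

section
/- Let r ≥ 2 and for each n ∈ ℕ let ρ₁⁽ⁿ⁾, …, ρᵣ⁽ⁿ⁾ be density matrices on ℂ^{d_n} (for some dimensions d_n), and let p₁, …, pᵣ ∈ (0,1) with ∑ᵢ pᵢ = 1 be prior probabilities. Assume that for every pair 1 ≤ i < j ≤ r there is a real number ξ_{ij} ≥ 0 such that for EVERY sequence (T_n) of matrices with 0 ≤ T_n ≤ 1 on ℂ^{d_n} one has limsup_{n→∞} −(1/n) log ( ½·tr[ρᵢ⁽ⁿ⁾(1 − T_n)] + ½·tr[ρⱼ⁽ⁿ⁾ T_n] ) ≤ ξ_{ij} (limsup in the extended reals). Then for every sequence (E⁽ⁿ⁾) of r-outcome POVMs on ℂ^{d_n}, limsup_{n→∞} −(1/n) log Err(E⁽ⁿ⁾) ≤ min_{1≤i<j≤r} ξ_{ij}, where Err(E⁽ⁿ⁾) = ∑_{i=1}^r pᵢ · tr[ρᵢ⁽ⁿ⁾(1 − Eᵢ⁽ⁿ⁾)]. -/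
open Filter Matrix
open scoped ComplexOrder

/-- The error-exponent sequence `n ↦ -(1/n) log (a n)`, valued in the extended reals,
with the convention `-log 0 = ⊤`. -/
noncomputable def expRateSeq (a : ℕ → ℝ) : ℕ → EReal := fun n =>
  if a n = 0 then ⊤ else ((-(1 / (n : ℝ)) * Real.log (a n) : ℝ) : EReal)

open scoped MatrixOrder in
/-- The trace of a product of two positive semidefinite matrices has nonnegative real part. -/
lemma Matrix.PosSemidef.trace_mul_re_nonneg {m : Type*} [Fintype m]
    {A B : Matrix m m ℂ} (hA : A.PosSemidef) (hB : B.PosSemidef) : 0 ≤ (A * B).trace.re := by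
  classical
  obtain ⟨C, rfl⟩ := CStarAlgebra.nonneg_iff_eq_star_mul_self.mp hA.nonneg
  rw [Matrix.star_eq_conjTranspose]
  have h := (hB.mul_mul_conjTranspose_same C).trace_nonneg
  rw [Matrix.mul_assoc, Matrix.trace_mul_comm]
  exact (Complex.le_def.mp h).1

/-- In a finite resolution of the identity into positive semidefinite matrices, the complement of
each effect is positive semidefinite. -/
lemma posSemidef_one_sub_of_sum_eq_one {ι m : Type*} [Fintype ι] [Fintype m] [DecidableEq m]
    {E : ι → Matrix m m ℂ} (hE : ∀ i, (E i).PosSemidef) (hsum : ∑ i, E i = 1) (i : ι) :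
    (1 - E i).PosSemidef := by
  classical
  rw [← hsum, ← Finset.add_sum_erase _ _ (Finset.mem_univ i), add_sub_cancel_left]
  exact Matrix.posSemidef_sum _ fun k _ => hE k

/-- In a finite resolution of the identity into positive semidefinite matrices, the complement of
the sum of two distinct effects is positive semidefinite. -/
lemma posSemidef_one_sub_sub_of_sum_eq_one {ι m : Type*} [Fintype ι] [Fintype m] [DecidableEq m]
    {E : ι → Matrix m m ℂ} (hE : ∀ i, (E i).PosSemidef) (hsum : ∑ i, E i = 1) {i j : ι}
    (hij : i ≠ j) : (1 - E j - E i).PosSemidef := by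
  classical
  rw [← hsum, ← Finset.add_sum_erase _ _ (Finset.mem_univ j), add_sub_cancel_left,
    ← Finset.add_sum_erase _ _ (Finset.mem_erase.mpr ⟨hij, Finset.mem_univ i⟩),
    add_sub_cancel_left]
  exact Matrix.posSemidef_sum _ fun k _ => hE k

/-- A constant positive factor does not affect the limsup error exponent. -/
lemma limsup_expRateSeq_le_of_mul_le {a b : ℕ → ℝ} {c : ℝ} (hc : 0 < c) (hb : ∀ n, 0 ≤ b n)
    (hab : ∀ n, c * b n ≤ a n) :
    limsup (expRateSeq a) atTop ≤ limsup (expRateSeq b) atTop := by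
  let v : ℕ → EReal := fun n => ((-(1 / (n : ℝ)) * Real.log c : ℝ) : EReal)
  have hv : limsup v atTop = 0 := by
    refine Tendsto.limsup_eq ?_
    have h : Tendsto (fun n : ℕ => -(1 / (n : ℝ)) * Real.log c) atTop (nhds 0) := by
      simpa using (tendsto_one_div_atTop_nhds_zero_nat (𝕜 := ℝ)).neg.mul_const (Real.log c)
    exact (continuous_coe_real_ereal.tendsto 0).comp h
  have hle : ∀ n, expRateSeq a n ≤ (expRateSeq b + v) n := by
    intro n
    rcases (hb n).eq_or_lt with h0 | hpos
    · simp only [Pi.add_apply, expRateSeq, ← h0, if_true, v, EReal.top_add_coe, le_top]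
    · have hcb : 0 < c * b n := mul_pos hc hpos
      have hlog := Real.log_le_log hcb (hab n)
      rw [Real.log_mul hc.ne' hpos.ne'] at hlog
      simp only [expRateSeq, Pi.add_apply, v, if_neg (hcb.trans_le (hab n)).ne',
        if_neg hpos.ne', ← EReal.coe_add, EReal.coe_le_coe_iff]
      have := mul_le_mul_of_nonneg_left hlog (one_div_nonneg.mpr (Nat.cast_nonneg (α := ℝ) n))
      linarith
  calc limsup (expRateSeq a) atTop ≤ limsup (expRateSeq b + v) atTop :=
        limsup_le_limsup (Eventually.of_forall hle)
    _ ≤ limsup (expRateSeq b) atTop + limsup v atTop :=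
        EReal.limsup_add_le (.inr (by simp [hv])) (.inr (by simp [hv]))
    _ = limsup (expRateSeq b) atTop := by rw [hv, add_zero]

/-- **Theorem 1 (Chernoff-type upper bound for multiple quantum hypothesis testing).**
If for each pair `i < j` the exponent `ξ i j` is an upper bound on the limsup error
exponent of every sequence of binary tests between `ρ n i` and `ρ n j` (with uniform
priors `1/2`), then for every sequence of `r`-outcome POVMs the limsup exponent of the
averaged error probability is at most `min_{i<j} ξ i j`. -/
theorem multiple_quantum_chernoff_upper_bound
    (r : ℕ) (hr : 2 ≤ r) (d : ℕ → ℕ)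
    (ρ : ∀ n, Fin r → Matrix (Fin (d n)) (Fin (d n)) ℂ)
    (hρpos : ∀ n i, (ρ n i).PosSemidef) (hρtr : ∀ n i, (ρ n i).trace = 1)
    (p : Fin r → ℝ) (hp : ∀ i, 0 < p i ∧ p i < 1) (hpsum : ∑ i, p i = 1)
    (ξ : Fin r → Fin r → ℝ) (hξnonneg : ∀ i j, i < j → 0 ≤ ξ i j)
    (hbinary : ∀ i j, i < j →
      ∀ T : ∀ n, Matrix (Fin (d n)) (Fin (d n)) ℂ,
        (∀ n, (T n).PosSemidef) → (∀ n, (1 - T n).PosSemidef) →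
        limsup (expRateSeq (fun n =>
            (1 / 2) * ((ρ n i) * (1 - T n)).trace.re
              + (1 / 2) * ((ρ n j) * (T n)).trace.re)) atTop ≤ (ξ i j : EReal))
    (E : ∀ n, Fin r → Matrix (Fin (d n)) (Fin (d n)) ℂ)
    (hEpos : ∀ n i, (E n i).PosSemidef) (hEsum : ∀ n, ∑ i, E n i = 1) :
    ∀ i j, i < j →
      limsup (expRateSeq (fun n =>
          ∑ k, p k * ((ρ n k) * (1 - E n k)).trace.re)) atTop ≤ (ξ i j : EReal) := by
  intro i j hij
  have hcompl : ∀ n k, (1 - E n k).PosSemidef := fun n =>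
    posSemidef_one_sub_of_sum_eq_one (hEpos n) (hEsum n)
  have hc : 0 < min (p i) (p j) := lt_min (hp i).1 (hp j).1
  refine (limsup_expRateSeq_le_of_mul_le hc (fun n => ?_) (fun n => ?_)).trans
    (hbinary i j hij (fun n => E n i) (fun n => hEpos n i) (fun n => hcompl n i))
  · have h₁ := (hρpos n i).trace_mul_re_nonneg (hcompl n i)
    have h₂ := (hρpos n j).trace_mul_re_nonneg (hEpos n i)
    positivity
  · have hnonneg : ∀ k, 0 ≤ (ρ n k * (1 - E n k)).trace.re := fun k =>
      (hρpos n k).trace_mul_re_nonneg (hcompl n k)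
    have hpair := Finset.sum_le_sum_of_subset_of_nonneg (Finset.subset_univ {i, j})
      fun k _ _ => mul_nonneg (hp k).1.le (hnonneg k)
    rw [Finset.sum_pair hij.ne] at hpair
    have hEij := (hρpos n j).trace_mul_re_nonneg
      (posSemidef_one_sub_sub_of_sum_eq_one (hEpos n) (hEsum n) hij.ne)
    rw [Matrix.mul_sub, Matrix.trace_sub, Complex.sub_re, sub_nonneg] at hEij
    have hi := mul_le_mul_of_nonneg_right (min_le_left (p i) (p j)) (hnonneg i)
    have hj := mul_le_mul_of_nonneg_right (min_le_right (p i) (p j)) (hnonneg j)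
    have hmin := mul_le_mul_of_nonneg_left hEij hc.le
    have := mul_nonneg hc.le (hnonneg i)
    have := mul_nonneg hc.le (hnonneg j)
    linarith
end

section
/- Let r ≥ 2 and let ρ₁, …, ρᵣ be density matrices on ℂ^d. For 1 ≤ i < j ≤ r set ξ_{ij} := −log inf_{s ∈ [0,1]} tr[ρᵢ^{1−s} ρⱼ^{s}] (the quantum Chernoff distance) and assume ξ_{ij} > 0 for all pairs. Assume further that for each pair i < j there exists a sequence of binary tests, i.e. matrices T_n^{ij} with 0 ≤ T_n^{ij} ≤ 1 on the n-fold tensor power (ℂ^d)^{⊗n}, such that liminf_{n→∞} −(1/n) log tr[ρᵢ^{⊗n}(1 − T_n^{ij})] ≥ ξ_{ij} and liminf_{n→∞} −(1/n) log tr[ρⱼ^{⊗n} T_n^{ij}] ≥ ξ_{ij}. Then there exists a sequence (E⁽ⁿ⁾) of r-outcome POVMs on (ℂ^d)^{⊗n} such that for every choice of prior probabilities p₁,…,pᵣ ∈ (0,1) with ∑ᵢ pᵢ = 1, liminf_{n→∞} −(1/n) log ( ∑_{i=1}^r pᵢ · tr[ρᵢ^{⊗n}(1 − Eᵢ⁽ⁿ⁾)]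 ) ≥ ( ∑_{1≤i<j≤r} 1/ξ_{ij} )^{-1} = ξ_QCB(Σ)·φ(Σ), where ξ_QCB(Σ) := min_{i<j} ξ_{ij} and φ(Σ) := ( ∑_{1≤i<j≤r} ξ_QCB(Σ)/ξ_{ij} )^{-1}. -/
open Filter Matrix
open scoped ComplexOrder

/-- Real power `A ^ s` of a Hermitian matrix via the spectral decomposition
(continuous functional calculus), with the convention `A ^ 0 = 1`; junk value `0`
on non-Hermitian input. -/
noncomputable def matRpow {n : Type*} [Fintype n] [DecidableEq n]
    (A : Matrix n n ℂ) (s : ℝ) : Matrix n n ℂ :=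
  if hA : A.IsHermitian then
    (hA.eigenvectorUnitary : Matrix n n ℂ) *
      Matrix.diagonal (fun i => ((hA.eigenvalues i ^ s : ℝ) : ℂ)) *
      star (hA.eigenvectorUnitary : Matrix n n ℂ)
  else 0

/-- The `n`-fold tensor (Kronecker) power `ρ^{⊗n}` of a matrix on `ℂ^d`, as a matrix
indexed by tuples in `(Fin d)^n`. -/
def tensorPow {d : ℕ} (ρ : Matrix (Fin d) (Fin d) ℂ) (n : ℕ) :
    Matrix (Fin n → Fin d) (Fin n → Fin d) ℂ :=
  Matrix.of fun x y => ∏ k, ρ (x k) (y k)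

/-- The quantum Chernoff distance `ξ_QCB(ρ,σ) = -log inf_{s ∈ [0,1]} tr[ρ^{1-s} σ^s]`. -/
noncomputable def chernoffDist {d : ℕ} (ρ σ : Matrix (Fin d) (Fin d) ℂ) : ℝ :=
  -Real.log (sInf
    ((fun s : ℝ => (matRpow ρ (1 - s) * matRpow σ s).trace.re) '' Set.Icc (0 : ℝ) 1))

section PiTensor

variable {ι : Type*} [Fintype ι] {X : ι → Type*}

/-- The tensor (Kronecker) product of a finite family of square matrices. -/
def piTensor (A : ∀ k, Matrix (X k) (X k) ℂ) : Matrix (∀ k, X k) (∀ k, X k) ℂ :=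
  Matrix.of fun x y => ∏ k, A k (x k) (y k)

theorem piTensor_one [∀ k, DecidableEq (X k)] [DecidableEq (∀ k, X k)] :
    piTensor (fun k => (1 : Matrix (X k) (X k) ℂ)) = 1 := by
  ext x y
  simp only [piTensor, Matrix.of_apply, Matrix.one_apply]
  by_cases h : x = y
  · simp [h]
  · obtain ⟨k, hk⟩ := Function.ne_iff.mp h
    rw [if_neg h]
    exact Finset.prod_eq_zero (Finset.mem_univ k) (if_neg hk)

theorem piTensor_conjTranspose (A : ∀ k, Matrix (X k) (X k) ℂ) :
    (piTensor A)ᴴ = piTensor fun k => (A k)ᴴ := by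
  ext x y
  simp [piTensor, Matrix.conjTranspose_apply]

variable [DecidableEq ι]

theorem sum_piTensor {κ : ι → Type*} [∀ k, Fintype (κ k)]
    (A : ∀ k, κ k → Matrix (X k) (X k) ℂ) :
    ∑ ω : ∀ k, κ k, piTensor (fun k => A k (ω k)) = piTensor fun k => ∑ b, A k b := by
  ext x y
  simp [piTensor, Matrix.sum_apply, Fintype.prod_sum]

variable [∀ k, Fintype (X k)]

theorem piTensor_mul (A B : ∀ k, Matrix (X k) (X k) ℂ) :
    piTensor A * piTensor B = piTensor fun k => A k * B k := by
  ext x y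
  simp [piTensor, Matrix.mul_apply, Fintype.prod_sum, Finset.prod_mul_distrib]

theorem trace_piTensor (A : ∀ k, Matrix (X k) (X k) ℂ) :
    (piTensor A).trace = ∏ k, (A k).trace := by
  simp [piTensor, Matrix.trace, Fintype.prod_sum]

end PiTensor

open scoped MatrixOrder in
theorem Matrix.PosSemidef.exists_eq_conjTranspose_mul_self {n : Type*} [Fintype n] [DecidableEq n]
    {A : Matrix n n ℂ} (hA : A.PosSemidef) : ∃ B : Matrix n n ℂ, A = Bᴴ * B :=
  CStarAlgebra.nonneg_iff_eq_star_mul_self.mp (Matrix.nonneg_iff_posSemidef.mpr hA)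

theorem Matrix.PosSemidef.trace_mul_nonneg {n : Type*} [Fintype n] [DecidableEq n]
    {A B : Matrix n n ℂ} (hA : A.PosSemidef) (hB : B.PosSemidef) : 0 ≤ (A * B).trace := by
  obtain ⟨C, rfl⟩ := hA.exists_eq_conjTranspose_mul_self
  rw [Matrix.mul_assoc, Matrix.trace_mul_comm]
  exact (hB.mul_mul_conjTranspose_same C).trace_nonneg

theorem posSemidef_piTensor {ι : Type*} [Fintype ι] [DecidableEq ι] {X : ι → Type*}
    [∀ k, Fintype (X k)] [∀ k, DecidableEq (X k)] {A : ∀ k, Matrix (X k) (X k) ℂ}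
    (hA : ∀ k, (A k).PosSemidef) : (piTensor A).PosSemidef := by
  choose B hB using fun k => (hA k).exists_eq_conjTranspose_mul_self
  have h : piTensor A = (piTensor B)ᴴ * piTensor B := by
    rw [piTensor_conjTranspose, piTensor_mul]
    exact congrArg piTensor (funext hB)
  rw [h]
  exact Matrix.posSemidef_conjTranspose_mul_self _

theorem posSemidef_tensorPow {d : ℕ} {ρ : Matrix (Fin d) (Fin d) ℂ} (hρ : ρ.PosSemidef) (n : ℕ) :
    (tensorPow ρ n).PosSemidef :=
  posSemidef_piTensor (A := fun _ : Fin n => ρ) fun _ => hρ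

theorem trace_tensorPow {d : ℕ} {ρ : Matrix (Fin d) (Fin d) ℂ} (hρ : ρ.trace = 1) (n : ℕ) :
    (tensorPow ρ n).trace = 1 := by
  have h : (tensorPow ρ n).trace = ∏ _ : Fin n, ρ.trace := trace_piTensor fun _ => ρ
  simp [h, hρ]

/-- Cutting a tuple of length `∑ p, m p` into blocks of lengths `m p`. -/
noncomputable def blockEquiv {P : Type*} [Fintype P] (d : ℕ) {n : ℕ} (m : P → ℕ)
    (h : ∑ p, m p = n) : (Fin n → Fin d) ≃ ∀ p, Fin (m p) → Fin d :=
  ((Fintype.equivFinOfCardEq (by simp [h]) : (Σ p, Fin (m p)) ≃ Fin n).symm.arrowCongr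
    (Equiv.refl _)).trans (Equiv.piCurry fun _ _ => Fin d)

theorem tensorPow_eq_submatrix_piTensor {P : Type*} [Fintype P] {d n : ℕ} (m : P → ℕ)
    (h : ∑ p, m p = n) (ρ : Matrix (Fin d) (Fin d) ℂ) :
    tensorPow ρ n = (piTensor fun p => tensorPow ρ (m p)).submatrix
      (blockEquiv d m h) (blockEquiv d m h) := by
  ext x y
  simp only [tensorPow, piTensor, Matrix.of_apply, Matrix.submatrix_apply]
  rw [← (Fintype.equivFinOfCardEq (by simp [h]) : (Σ p, Fin (m p)) ≃ Fin n).prod_comp,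
    Fintype.prod_sigma]
  rfl

theorem trace_submatrix_equiv {m n : Type*} [Fintype m] [Fintype n] (e : m ≃ n)
    (A : Matrix n n ℂ) : (A.submatrix e e).trace = A.trace :=
  e.sum_comp fun i => A i i

section Probability

variable {P κ : Type*} [Fintype P] [DecidableEq P] [Fintype κ]

theorem sum_mul_prod_eq_marginal {R : Type*} [CommSemiring R] (q : P → κ → R)
    (hq : ∀ p, ∑ b, q p b = 1) (p : P) (f : κ → R) :
    ∑ ω : P → κ, f (ω p) * ∏ k, q k (ω k) = ∑ b, f b * q p b := by
  have h := Fintype.prod_sum fun (k : P) (b : κ) => (if k = p then f b else 1) * q k b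
  simp only [Finset.prod_mul_distrib, Finset.prod_ite_eq', Finset.mem_univ, if_true] at h
  rw [← h, Finset.prod_eq_single p]
  · simp
  · intro k _ hk
    simp [hk, hq]
  · simp

/-- The union bound for a product of finite probability distributions, where `f p` dominates the
indicator of the outcomes of the `p`-th factor to be avoided. -/
theorem sum_prod_le_sum_mul (q : P → κ → ℝ) (hq0 : ∀ p b, 0 ≤ q p b)
    (hq : ∀ p, ∑ b, q p b = 1) (f : P → κ → ℝ) (hf : ∀ p b, 0 ≤ f p b)
    (S : Finset (P → κ)) (hS : ∀ ω ∈ S, ∃ p, 1 ≤ f p (ω p)) :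
    ∑ ω ∈ S, ∏ p, q p (ω p) ≤ ∑ p, ∑ b, f p b * q p b := by
  have hprod : ∀ ω : P → κ, 0 ≤ ∏ k, q k (ω k) := fun ω =>
    Finset.prod_nonneg fun k _ => hq0 k _
  have hsum : ∀ ω : P → κ, 0 ≤ ∑ p, f p (ω p) := fun ω => Finset.sum_nonneg fun p _ => hf p _
  have hle : ∀ ω ∈ S, ∏ p, q p (ω p) ≤ (∑ p, f p (ω p)) * ∏ k, q k (ω k) := fun ω hω => by
    obtain ⟨p, hp⟩ := hS ω hω
    refine le_mul_of_one_le_left (hprod ω) (hp.trans ?_)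
    exact Finset.single_le_sum (f := fun p => f p (ω p)) (fun p _ => hf p _) (Finset.mem_univ p)
  refine (Finset.sum_le_sum hle).trans ?_
  refine (Finset.sum_le_sum_of_subset_of_nonneg (Finset.subset_univ S) fun ω _ _ =>
    mul_nonneg (hsum ω) (hprod ω)).trans (le_of_eq ?_)
  simp only [Finset.sum_mul]
  rw [Finset.sum_comm]
  exact Finset.sum_congr rfl fun p _ => sum_mul_prod_eq_marginal q hq p (f p)

end Probability

/-- In a tournament `ω` (where `ω (i, j)` says that `i` beats `j`), pick the player who wins all
matches, if there is one. -/
theorem exists_tournament_decision {r : ℕ} (hr : 0 < r) :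
    ∃ dec : ({ij : Fin r × Fin r // ij.1 < ij.2} → Bool) → Fin r, ∀ ω i, dec ω ≠ i →
      ∃ p, (p.1.1 = i ∧ ω p = false) ∨ (p.1.2 = i ∧ ω p = true) := by
  classical
  let wins (ω : {ij : Fin r × Fin r // ij.1 < ij.2} → Bool) (i : Fin r) : Prop :=
    ∀ p, (p.1.1 = i → ω p = true) ∧ (p.1.2 = i → ω p = false)
  have huniq : ∀ ω i j, i < j → wins ω i → wins ω j → False := fun ω i j hij hi hj => by
    have h1 := (hi ⟨(i, j), hij⟩).1 rfl
    have h2 := (hj ⟨(i, j), hij⟩).2 rfl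
    simp [h1] at h2
  refine ⟨fun ω => if h : ∃ i, wins ω i then h.choose else ⟨0, hr⟩, fun ω i hne => ?_⟩
  by_contra hcon
  have hi : wins ω i := fun p => by
    constructor <;> intro hp <;> by_contra hω <;> refine hcon ⟨p, ?_⟩
    · exact Or.inl ⟨hp, by simpa using hω⟩
    · exact Or.inr ⟨hp, by simpa using hω⟩
  have hex : ∃ i, wins ω i := ⟨i, hi⟩
  simp only [dif_pos hex] at hne
  rcases lt_or_gt_of_ne hne with h | h
  · exact huniq ω _ _ h hex.choose_spec hi
  · exact huniq ω _ _ h hi hex.choose_spec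

/-- Combining binary tests for all pairs, applied to disjoint blocks of copies, into one POVM whose
error probabilities are bounded by the sum of all errors of the binary tests. -/
theorem exists_povm_of_binary_tests {d r n : ℕ} (hr : 0 < r)
    (ρ : Fin r → Matrix (Fin d) (Fin d) ℂ)
    (hρpos : ∀ i, (ρ i).PosSemidef) (hρtr : ∀ i, (ρ i).trace = 1)
    (m : {ij : Fin r × Fin r // ij.1 < ij.2} → ℕ) (hm : ∑ p, m p = n)
    (T : ∀ p, Matrix (Fin (m p) → Fin d) (Fin (m p) → Fin d) ℂ)
    (hT : ∀ p, (T p).PosSemidef) (hT' : ∀ p, (1 - T p).PosSemidef) :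
    ∃ E : Fin r → Matrix (Fin n → Fin d) (Fin n → Fin d) ℂ,
      (∀ i, (E i).PosSemidef) ∧ ∑ i, E i = 1 ∧
      ∀ i, (tensorPow (ρ i) n * (1 - E i)).trace.re ≤
        ∑ p, ((tensorPow (ρ p.1.1) (m p) * (1 - T p)).trace.re +
          (tensorPow (ρ p.1.2) (m p) * T p).trace.re) := by
  obtain ⟨dec, hdec⟩ := exists_tournament_decision hr
  let e := blockEquiv d m hm
  let F : ∀ p, Bool → Matrix (Fin (m p) → Fin d) (Fin (m p) → Fin d) ℂ :=
    fun p b => if b then T p else 1 - T p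
  have hF : ∀ p b, (F p b).PosSemidef := fun p b => by
    cases b
    · exact hT' p
    · exact hT p
  have hFsum : ∀ p, ∑ b, F p b = 1 := fun p => by simp [F]
  let M : ({ij : Fin r × Fin r // ij.1 < ij.2} → Bool) →
      Matrix (Fin n → Fin d) (Fin n → Fin d) ℂ :=
    fun ω => (piTensor fun p => F p (ω p)).submatrix e e
  have hM : ∀ ω, (M ω).PosSemidef := fun ω => (posSemidef_piTensor fun p => hF p _).submatrix e
  have hMsum : ∑ ω, M ω = 1 := by
    have h : ∑ ω, M ω = (∑ ω : _ → Bool, piTensor fun p => F p (ω p)).submatrix e e := by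
      ext x y
      simp [M, Matrix.sum_apply]
    rw [h, sum_piTensor]
    simp only [hFsum, piTensor_one, Matrix.submatrix_one_equiv]
  have hEsum : ∑ i, ∑ ω with dec ω = i, M ω = 1 := by
    rw [Finset.sum_fiberwise, hMsum]
  refine ⟨fun i => ∑ ω with dec ω = i, M ω, fun i => Matrix.posSemidef_sum _ fun ω _ => hM ω,
    hEsum, fun i => ?_⟩
  have hcompl : 1 - ∑ ω with dec ω = i, M ω = ∑ ω with dec ω ≠ i, M ω := by
    rw [← hMsum, ← Finset.sum_filter_add_sum_filter_not Finset.univ (fun ω => dec ω = i)]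
    simp
  let q : {ij : Fin r × Fin r // ij.1 < ij.2} → Bool → ℝ :=
    fun p b => (tensorPow (ρ i) (m p) * F p b).trace.re
  have hnn : ∀ j p b, 0 ≤ (tensorPow (ρ j) (m p) * F p b).trace := fun j p b =>
    (posSemidef_tensorPow (hρpos j) _).trace_mul_nonneg (hF p b)
  have hnnre : ∀ j p b, 0 ≤ (tensorPow (ρ j) (m p) * F p b).trace.re := fun j p b =>
    (Complex.nonneg_iff.mp (hnn j p b)).1
  have hqC : ∀ p b, (tensorPow (ρ i) (m p) * F p b).trace = (q p b : ℂ) := fun p b =>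
    Complex.eq_re_of_ofReal_le (r := 0) (by simpa using hnn i p b)
  have hq : ∀ p, ∑ b, q p b = 1 := fun p => by
    simp only [q]
    rw [← Complex.re_sum, ← Matrix.trace_sum, ← Finset.mul_sum, hFsum, mul_one,
      trace_tensorPow (hρtr i), Complex.one_re]
  have hprob : ∀ ω, (tensorPow (ρ i) n * M ω).trace.re = ∏ p, q p (ω p) := fun ω => by
    rw [tensorPow_eq_submatrix_piTensor m hm, Matrix.submatrix_mul_equiv, trace_submatrix_equiv,
      piTensor_mul, trace_piTensor]
    simp only [hqC, ← Complex.ofReal_prod, Complex.ofReal_re]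
  rw [hcompl, Finset.mul_sum, Matrix.trace_sum, Complex.re_sum,
    Finset.sum_congr rfl fun ω _ => hprob ω]
  refine (sum_prod_le_sum_mul q (hnnre i) hq
    (fun p b => if (p.1.1 = i ∧ b = false) ∨ (p.1.2 = i ∧ b = true) then 1 else 0)
    (fun p b => by split_ifs <;> norm_num) _ fun ω hω => ?_).trans ?_
  · obtain ⟨p, hp⟩ := hdec ω i (Finset.mem_filter.mp hω).2
    exact ⟨p, by rw [if_pos hp]⟩
  refine Finset.sum_le_sum fun p _ => ?_
  have h1 : 0 ≤ (tensorPow (ρ p.1.1) (m p) * (1 - T p)).trace.re := hnnre p.1.1 p false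
  have h2 : 0 ≤ (tensorPow (ρ p.1.2) (m p) * T p).trace.re := hnnre p.1.2 p true
  rw [Fintype.sum_bool, add_comm]
  refine add_le_add ?_ ?_
  · by_cases h : p.1.1 = i
    · simp [h, q, F]
    · simpa [h] using h1
  · by_cases h : p.1.2 = i
    · simp [h, q, F]
    · simpa [h] using h2

theorem eventually_le_exp_of_lt_liminf_expRateSeq {a : ℕ → ℝ} (ha : ∀ n, 0 ≤ a n) {c ξ : ℝ}
    (hc : c < ξ) (h : (ξ : EReal) ≤ liminf (expRateSeq a) atTop) :
    ∀ᶠ n : ℕ in atTop, a n ≤ Real.exp (-(c * n)) := by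
  have hlt := eventually_lt_of_lt_liminf ((EReal.coe_lt_coe_iff.mpr hc).trans_le h)
  filter_upwards [hlt, eventually_gt_atTop 0] with n hn hn0
  by_cases h0 : a n = 0
  · rw [h0]
    positivity
  · rw [expRateSeq, if_neg h0, EReal.coe_lt_coe_iff] at hn
    have hn0' : (0 : ℝ) < n := by exact_mod_cast hn0
    rw [← Real.log_le_iff_le_exp (lt_of_le_of_ne (ha n) (Ne.symm h0))]
    have h2 : c * n < (-(1 / (n : ℝ)) * Real.log (a n)) * n := mul_lt_mul_of_pos_right hn hn0'
    have h3 : (-(1 / (n : ℝ)) * Real.log (a n)) * n = -Real.log (a n) := by field_simp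
    linarith

theorem le_liminf_expRateSeq {a : ℕ → ℝ} (ha : ∀ n, 0 ≤ a n) {ξ : ℝ} (hξ : 0 < ξ)
    (h : ∀ c, 0 < c → c < ξ → ∃ K, ∀ᶠ n : ℕ in atTop, a n ≤ K * Real.exp (-(c * n))) :
    (ξ : EReal) ≤ liminf (expRateSeq a) atTop := by
  refine EReal.ge_of_forall_gt_iff_ge.mp fun b hb => ?_
  rw [EReal.coe_lt_coe_iff] at hb
  obtain ⟨c, hc, hcξ⟩ := exists_between (max_lt hb hξ)
  obtain ⟨hbc, hc0⟩ := max_lt_iff.mp hc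
  obtain ⟨K, hK⟩ := h c hc0 hcξ
  have hlarge : ∀ᶠ n : ℕ in atTop, K ≤ (c - b) * n :=
    (tendsto_natCast_atTop_atTop.const_mul_atTop (sub_pos.mpr hbc)).eventually_ge_atTop K
  refine le_liminf_of_le (h := ?_)
  filter_upwards [hK, hlarge, eventually_gt_atTop 0] with n hn hl hn0
  unfold expRateSeq
  split_ifs with h0
  · exact le_top
  · have hn0' : (0 : ℝ) < n := by exact_mod_cast hn0
    have hexp : a n ≤ Real.exp (-(b * n)) := by
      refine hn.trans ?_
      have hK' : K ≤ Real.exp ((c - b) * n) :=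
        hl.trans ((le_add_of_nonneg_right zero_le_one).trans (Real.add_one_le_exp _))
      calc K * Real.exp (-(c * n))
          ≤ Real.exp ((c - b) * n) * Real.exp (-(c * n)) := by gcongr
        _ = Real.exp (-(b * n)) := by rw [← Real.exp_add]; ring_nf
    rw [← Real.log_le_iff_le_exp (lt_of_le_of_ne (ha n) (Ne.symm h0))] at hexp
    rw [EReal.coe_le_coe_iff]
    have h3 : -(1 / (n : ℝ)) * Real.log (a n) = -Real.log (a n) / n := by ring
    rw [h3, le_div_iff₀ hn0']
    linarith

/-- Splitting `n` into blocks whose sizes are proportional to given weights, up to rounding. -/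
theorem exists_block_sizes {P : Type*} [Fintype P] [Nonempty P] (w : P → ℝ) (hw : ∀ p, 0 ≤ w p)
    (hsum : ∑ p, w p = 1) (n : ℕ) :
    ∃ m : P → ℕ, ∑ p, m p = n ∧ ∀ p, n * w p - 1 ≤ m p := by
  classical
  obtain ⟨p₀⟩ := ‹Nonempty P›
  have hle : ∑ p, ⌊n * w p⌋₊ ≤ n := by
    have h : ((∑ p, ⌊n * w p⌋₊ : ℕ) : ℝ) ≤ n := by
      push_cast
      calc ∑ p, (⌊n * w p⌋₊ : ℝ) ≤ ∑ p, n * w p :=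
            Finset.sum_le_sum fun p _ => Nat.floor_le (mul_nonneg n.cast_nonneg (hw p))
        _ = n := by rw [← Finset.mul_sum, hsum, mul_one]
    exact_mod_cast h
  refine ⟨fun p => ⌊n * w p⌋₊ + if p = p₀ then n - ∑ p, ⌊n * w p⌋₊ else 0, ?_, fun p => ?_⟩
  · rw [Finset.sum_add_distrib, Finset.sum_ite_eq' Finset.univ p₀, if_pos (Finset.mem_univ _)]
    omega
  · have h := Nat.sub_one_lt_floor (n * w p)
    have h' : (0 : ℝ) ≤ ((if p = p₀ then n - ∑ p, ⌊n * w p⌋₊ else 0 : ℕ) : ℝ) := Nat.cast_nonneg _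
    rw [Nat.cast_add]
    linarith

/-- An exponential bound evaluated along block sizes `m n ≥ n * w - 1`. -/
theorem eventually_comp_le_exp {a : ℕ → ℝ} {m : ℕ → ℕ} {c w : ℝ} (hc : 0 < c) (hw : 0 < w)
    (hm : ∀ n : ℕ, n * w - 1 ≤ m n)
    (ha : ∀ᶠ k : ℕ in atTop, a k ≤ Real.exp (-(c * k))) :
    ∀ᶠ n : ℕ in atTop, a (m n) ≤ Real.exp c * Real.exp (-(c * w * n)) := by
  have htend : Tendsto m atTop atTop := by
    rw [← tendsto_natCast_atTop_iff (R := ℝ)]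
    refine tendsto_atTop_mono hm ?_
    exact tendsto_atTop_add_const_right _ (-1)
      (tendsto_natCast_atTop_atTop.atTop_mul_const hw)
  filter_upwards [htend.eventually ha] with n hn
  refine hn.trans ?_
  rw [← Real.exp_add, Real.exp_le_exp]
  nlinarith [mul_le_mul_of_nonneg_left (hm n) hc.le]

/-- **Theorem 2 (achievability, i.i.d. case).** If all pairwise quantum Chernoff
distances `ξ_{ij} = chernoffDist (ρ i) (ρ j)` are positive and each is achievable by a
sequence of binary tests on the tensor powers, then there is a sequence of `r`-outcome
POVMs whose averaged error probability decays, for every choice of priors, with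
exponent at least `(∑_{i<j} 1/ξ_{ij})⁻¹ = ξ_QCB(Σ)·φ(Σ)`, where
`ξ_QCB(Σ) = min_{i<j} ξ_{ij}` and `φ(Σ) = (∑_{i<j} ξ_QCB(Σ)/ξ_{ij})⁻¹`. -/
theorem multiple_chernoff_achievability_iid (d r : ℕ) (hr : 2 ≤ r)
    (ρ : Fin r → Matrix (Fin d) (Fin d) ℂ)
    (hρpos : ∀ i, (ρ i).PosSemidef) (hρtr : ∀ i, (ρ i).trace = 1)
    (hξpos : ∀ i j : Fin r, i < j → 0 < chernoffDist (ρ i) (ρ j))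
    (htests : ∀ i j : Fin r, i < j →
      ∃ T : ∀ n : ℕ, Matrix (Fin n → Fin d) (Fin n → Fin d) ℂ,
        (∀ n, (T n).PosSemidef) ∧ (∀ n, (1 - T n).PosSemidef) ∧
        ((chernoffDist (ρ i) (ρ j) : ℝ) : EReal) ≤
          liminf (expRateSeq fun n =>
            (tensorPow (ρ i) n * (1 - T n)).trace.re) atTop ∧
        ((chernoffDist (ρ i) (ρ j) : ℝ) : EReal) ≤
          liminf (expRateSeq fun n =>
            (tensorPow (ρ j) n * T n).trace.re) atTop) :
    (∃ E : ∀ n : ℕ, Fin r → Matrix (Fin n → Fin d) (Fin n → Fin d) ℂ,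
      (∀ n i, (E n i).PosSemidef) ∧ (∀ n, ∑ i, E n i = 1) ∧
      ∀ p : Fin r → ℝ, (∀ i, 0 < p i ∧ p i < 1) → (∑ i, p i) = 1 →
        (((∑ ij ∈ Finset.univ.filter (fun ij : Fin r × Fin r => ij.1 < ij.2),
            1 / chernoffDist (ρ ij.1) (ρ ij.2))⁻¹ : ℝ) : EReal) ≤
          liminf (expRateSeq fun n =>
            ∑ i, p i * (tensorPow (ρ i) n * (1 - E n i)).trace.re) atTop) ∧
    -- the bound `(∑_{i<j} 1/ξ_{ij})⁻¹` equals `ξ_QCB(Σ) · φ(Σ)`: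
    ((∑ ij ∈ Finset.univ.filter (fun ij : Fin r × Fin r => ij.1 < ij.2),
        1 / chernoffDist (ρ ij.1) (ρ ij.2))⁻¹
      = sInf {x : ℝ | ∃ i j : Fin r, i < j ∧ x = chernoffDist (ρ i) (ρ j)} *
        (∑ ij ∈ Finset.univ.filter (fun ij : Fin r × Fin r => ij.1 < ij.2),
          sInf {x : ℝ | ∃ i j : Fin r, i < j ∧ x = chernoffDist (ρ i) (ρ j)} /
            chernoffDist (ρ ij.1) (ρ ij.2))⁻¹) := by
  classical
  let P := {ij : Fin r × Fin r // ij.1 < ij.2}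
  let ξ : P → ℝ := fun p => chernoffDist (ρ p.1.1) (ρ p.1.2)
  have hξ : ∀ p, 0 < ξ p := fun p => hξpos _ _ p.2
  let p₀ : P := ⟨(⟨0, by omega⟩, ⟨1, by omega⟩), by simp [Fin.lt_def]⟩
  have : Nonempty P := ⟨p₀⟩
  have hsumP : ∑ ij ∈ Finset.univ.filter (fun ij : Fin r × Fin r => ij.1 < ij.2),
      1 / chernoffDist (ρ ij.1) (ρ ij.2) = ∑ p, 1 / ξ p :=
    Finset.sum_subtype _ (by simp) fun ij : Fin r × Fin r =>
      1 / chernoffDist (ρ ij.1) (ρ ij.2)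
  have hpos : 0 < ∑ p, 1 / ξ p :=
    Finset.sum_pos (fun p _ => one_div_pos.mpr (hξ p)) Finset.univ_nonempty
  constructor
  · choose T hT hT' hα hβ using fun p : P => htests p.1.1 p.1.2 p.2
    set L : ℝ := (∑ p, 1 / ξ p)⁻¹
    have hLpos : 0 < L := inv_pos.mpr hpos
    have hwsum : ∑ p, L / ξ p = 1 := by
      simp only [div_eq_mul_one_div L, ← Finset.mul_sum]
      exact inv_mul_cancel₀ hpos.ne'
    choose m hm hmw using exists_block_sizes (fun p => L / ξ p)
      (fun p => (div_pos hLpos (hξ p)).le) hwsum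
    choose E hE hE1 herr using fun n => exists_povm_of_binary_tests (by omega) ρ hρpos hρtr
      (m n) (hm n) (fun p => T p (m n p)) (fun p => hT p _) (fun p => hT' p _)
    have hnn : ∀ i k {A : Matrix (Fin k → Fin d) (Fin k → Fin d) ℂ}, A.PosSemidef →
        0 ≤ (tensorPow (ρ i) k * A).trace.re := fun i k A hA =>
      (Complex.nonneg_iff.mp ((posSemidef_tensorPow (hρpos i) k).trace_mul_nonneg hA)).1
    have hE' : ∀ n i, (1 - E n i).PosSemidef := fun n i => by
      rw [← hE1 n, ← Finset.add_sum_erase _ _ (Finset.mem_univ i), add_sub_cancel_left]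
      exact Matrix.posSemidef_sum _ fun j _ => hE n j
    refine ⟨E, hE, hE1, fun p hp hp1 => ?_⟩
    rw [hsumP]
    refine le_liminf_expRateSeq (fun n => Finset.sum_nonneg fun i _ =>
      mul_nonneg (hp i).1.le (hnn i n (hE' n i))) hLpos fun c hc hcL => ?_
    let c' : P → ℝ := fun q => ξ q * (c / L)
    have hc' : ∀ q, 0 < c' q := fun q => mul_pos (hξ q) (div_pos hc hLpos)
    have hcξ : ∀ q, c' q < ξ q := fun q =>
      mul_lt_of_lt_one_right (hξ q) ((div_lt_one hLpos).mpr hcL)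
    have hcw : ∀ q, c' q * (L / ξ q) = c := fun q => by
      have := (hξ q).ne'
      simp only [c']
      field_simp
    have hbound : ∀ (q : P) (a : ℕ → ℝ), (∀ k, 0 ≤ a k) →
        (ξ q : EReal) ≤ liminf (expRateSeq a) atTop →
        ∀ᶠ n : ℕ in atTop, a (m n q) ≤ Real.exp (c' q) * Real.exp (-(c * n)) :=
      fun q a ha h => by
        have := eventually_comp_le_exp (hc' q) (div_pos hLpos (hξ q)) (fun n => hmw n q)
          (eventually_le_exp_of_lt_liminf_expRateSeq ha (hcξ q) h)
        rwa [hcw q] at this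
    refine ⟨∑ q, (Real.exp (c' q) + Real.exp (c' q)), ?_⟩
    filter_upwards [eventually_all.mpr fun q => hbound q _ (fun k => hnn _ k (hT' q k)) (hα q),
      eventually_all.mpr fun q => hbound q _ (fun k => hnn _ k (hT q k)) (hβ q)] with n hn1 hn2
    calc ∑ i, p i * (tensorPow (ρ i) n * (1 - E n i)).trace.re
        ≤ ∑ i, p i * ∑ q : P, ((tensorPow (ρ q.1.1) (m n q) * (1 - T q (m n q))).trace.re +
            (tensorPow (ρ q.1.2) (m n q) * T q (m n q)).trace.re) :=
          Finset.sum_le_sum fun i _ => mul_le_mul_of_nonneg_left (herr n i) (hp i).1.le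
      _ = ∑ q : P, ((tensorPow (ρ q.1.1) (m n q) * (1 - T q (m n q))).trace.re +
            (tensorPow (ρ q.1.2) (m n q) * T q (m n q)).trace.re) := by
          rw [← Finset.sum_mul, hp1, one_mul]
      _ ≤ ∑ q, (Real.exp (c' q) * Real.exp (-(c * n)) +
            Real.exp (c' q) * Real.exp (-(c * n))) :=
          Finset.sum_le_sum fun q _ => add_le_add (hn1 q) (hn2 q)
      _ = (∑ q, (Real.exp (c' q) + Real.exp (c' q))) * Real.exp (-(c * n)) := by
          simp only [Finset.sum_mul, add_mul]
  · have hset : {x : ℝ | ∃ i j : Fin r, i < j ∧ x = chernoffDist (ρ i) (ρ j)} = Set.range ξ := by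
      ext x
      constructor
      · rintro ⟨i, j, hij, rfl⟩
        exact ⟨⟨(i, j), hij⟩, rfl⟩
      · rintro ⟨p, rfl⟩
        exact ⟨p.1.1, p.1.2, p.2, rfl⟩
    obtain ⟨p, hp⟩ := (Set.range_nonempty ξ).csInf_mem (Set.finite_range ξ)
    rw [hset, ← hp]
    simp only [div_eq_mul_one_div (ξ p), ← Finset.mul_sum]
    rw [mul_inv, mul_inv_cancel_left₀ (hξ p).ne']
end

section
/- Let r ≥ 2, let ι be a bijection from {1,…,m} (with m = r(r−1)/2) to the set of pairs { (i,j) : 1 ≤ i < j ≤ r }. For each k with ι(k) = (i,j) let T_k be a matrix on ℂ^{D_k} with 0 ≤ T_k ≤ 1, interpreted as a binary test accepting i (with acceptance operator T_k) versus j (with acceptance operator 1 − T_k). For b ∈ {0,1}^m let P_b := ⊗_{k=1}^m Q_k^{b_k} where Q_k⁰ := T_k, Q_k¹ := 1 − T_k, let n_i(b) be the number of blocks k whose vote under b is for hypothesis i, i.e. the number of k such that ι(k) = (i,j) for some j with b_k = 0, or ι(k) = (j,i) for some j with b_k = 1, define B_i := { b : n_i(b) > n_j(b) ∀ j<i, n_i(b)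 ≥ n_j(b) ∀ j≥i } and E_i := ∑_{b ∈ B_i} P_b. Then (E₁,…,E_r) is an r-outcome POVM on ⊗_k ℂ^{D_k}, and for every i and every family of density matrices σ₁,…,σ_m with σ_k on ℂ^{D_k}, the product state σ := ⊗_k σ_k satisfies tr[σ(1 − E_i)] ≤ ∑_{k : i ∈ ι(k)} tr[σ_k R_k^{(i)}], where R_k^{(i)} is the operator of block k rejecting hypothesis i (R_k^{(i)} = 1 − T_k if ι(k) = (i,j), and R_k^{(i)} = T_k if ι(k) = (j,i) with j < i). -/
open Matrix
open scoped ComplexOrder Classical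

/-- The tensor (Kronecker) product `⊗_{k} Q k` of a family of matrices
`Q k : Matrix (Fin (D k)) (Fin (D k)) ℂ`, as a matrix indexed by tuples. -/
def tensorFam {m : ℕ} {D : Fin m → ℕ}
    (Q : ∀ k, Matrix (Fin (D k)) (Fin (D k)) ℂ) :
    Matrix (∀ k, Fin (D k)) (∀ k, Fin (D k)) ℂ :=
  Matrix.of fun x y => ∏ k, Q k (x k) (y k)

/-- The hypothesis for which block `k` votes under the outcome string `b`:
if `ι k = (i, j)` (with `i < j`), an outcome `b k = 0` (`false`) is a vote for `i`
and `b k = 1` (`true`) is a vote for `j`. -/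
def blockVote {r m : ℕ} (ι : Fin m ≃ {ij : Fin r × Fin r // ij.1 < ij.2})
    (b : Fin m → Bool) (k : Fin m) : Fin r :=
  if b k then (ι k).1.2 else (ι k).1.1

/-- The number `n_i(b)` of blocks voting for hypothesis `i` under the string `b`. -/
noncomputable def voteCount {r m : ℕ}
    (ι : Fin m ≃ {ij : Fin r × Fin r // ij.1 < ij.2})
    (i : Fin r) (b : Fin m → Bool) : ℕ :=
  (Finset.univ.filter fun k => blockVote ι b k = i).card

/-- The decision region `B_i`: outcome strings on which hypothesis `i` strictly beats
all earlier hypotheses and weakly beats all later ones (majority vote with ties broken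
by the numerical rank). -/
noncomputable def decisionSet {r m : ℕ}
    (ι : Fin m ≃ {ij : Fin r × Fin r // ij.1 < ij.2}) (i : Fin r) :
    Finset (Fin m → Bool) :=
  Finset.univ.filter fun b =>
    (∀ j, j < i → voteCount ι j b < voteCount ι i b) ∧
    (∀ j, i ≤ j → voteCount ι j b ≤ voteCount ι i b)

/-- The POVM element `E_i = ∑_{b ∈ B_i} P_b`, where
`P_b = ⊗_k (T k)^{b k}` with `(T k)⁰ = T k` and `(T k)¹ = 1 - T k`. -/
noncomputable def majorityTest {r m : ℕ} {D : Fin m → ℕ}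
    (ι : Fin m ≃ {ij : Fin r × Fin r // ij.1 < ij.2})
    (T : ∀ k, Matrix (Fin (D k)) (Fin (D k)) ℂ) (i : Fin r) :
    Matrix (∀ k, Fin (D k)) (∀ k, Fin (D k)) ℂ :=
  ∑ b ∈ decisionSet ι i, tensorFam fun k => if b k then 1 - T k else T k

namespace Matrix.PosSemidef

variable {n : Type*} [Fintype n]

theorem exists_eq_conjTranspose_mul_self_s7 {A : Matrix n n ℂ} (hA : A.PosSemidef) :
    ∃ B : Matrix n n ℂ, A = Bᴴ * B := by
  open scoped MatrixOrder in
  exact CStarAlgebra.nonneg_iff_eq_star_mul_self.mp hA.nonneg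

theorem trace_mul_nonneg_s7 {A B : Matrix n n ℂ} (hA : A.PosSemidef) (hB : B.PosSemidef) :
    0 ≤ (A * B).trace := by
  obtain ⟨C, rfl⟩ := hB.exists_eq_conjTranspose_mul_self_s7
  rw [← Matrix.mul_assoc, Matrix.trace_mul_comm, ← Matrix.mul_assoc]
  exact (hA.mul_mul_conjTranspose_same C).trace_nonneg

end Matrix.PosSemidef

section TensorFam

variable {m : ℕ} {D : Fin m → ℕ}

theorem tensorFam_mul (A B : ∀ k, Matrix (Fin (D k)) (Fin (D k)) ℂ) :
    tensorFam A * tensorFam B = tensorFam fun k => A k * B k := by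
  ext x y
  simp only [tensorFam, Matrix.mul_apply, Matrix.of_apply, ← Finset.prod_mul_distrib]
  exact (Fintype.prod_sum fun k z => A k (x k) z * B k z (y k)).symm

theorem trace_tensorFam (A : ∀ k, Matrix (Fin (D k)) (Fin (D k)) ℂ) :
    (tensorFam A).trace = ∏ k, (A k).trace :=
  (Fintype.prod_sum fun k z => A k z z).symm

theorem tensorFam_one :
    tensorFam (fun k => (1 : Matrix (Fin (D k)) (Fin (D k)) ℂ)) = 1 := by
  ext x y
  simp [tensorFam, Matrix.one_apply, Finset.prod_ite_zero, funext_iff]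

theorem sum_tensorFam {κ : Type*} [Fintype κ]
    (A : ∀ k, κ → Matrix (Fin (D k)) (Fin (D k)) ℂ) :
    ∑ b : Fin m → κ, tensorFam (fun k => A k (b k)) = tensorFam fun k => ∑ c, A k c := by
  ext x y
  simp only [tensorFam, Matrix.sum_apply, Matrix.of_apply]
  exact (Fintype.prod_sum fun k c => A k c (x k) (y k)).symm

theorem posSemidef_tensorFam {A : ∀ k, Matrix (Fin (D k)) (Fin (D k)) ℂ}
    (hA : ∀ k, (A k).PosSemidef) : (tensorFam A).PosSemidef := by
  choose B hB using fun k => (hA k).exists_eq_conjTranspose_mul_self_s7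
  have h : tensorFam A = (tensorFam B)ᴴ * tensorFam B := by
    have hstar : (tensorFam B)ᴴ = tensorFam fun k => (B k)ᴴ := by
      ext x y
      simp [tensorFam, Matrix.conjTranspose_apply]
    rw [hstar, tensorFam_mul]
    exact congrArg tensorFam (funext hB)
  rw [h]
  exact Matrix.posSemidef_conjTranspose_mul_self _

end TensorFam

/-- The marginal of a product of probability weights at one coordinate. -/
theorem sum_filter_prod_eq {α κ R : Type*} [Fintype α] [DecidableEq α] [Fintype κ]
    [DecidableEq κ] [CommSemiring R]
    (p : α → κ → R) (hp : ∀ k, ∑ c, p k c = 1) (k : α) (c : κ) :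
    ∑ b : α → κ with b k = c, ∏ l, p l (b l) = p k c := by
  have h := Fintype.prod_sum fun l d => if l = k ∧ d ≠ c then 0 else p l d
  rw [Finset.sum_filter]
  calc _ = ∑ b : α → κ, ∏ l, (if l = k ∧ b l ≠ c then 0 else p l (b l)) := by
        refine Finset.sum_congr rfl fun b _ => ?_
        split_ifs with hb
        · refine Finset.prod_congr rfl fun l _ => ?_
          rw [if_neg]
          rintro ⟨rfl, hl⟩
          exact hl hb
        · exact (Finset.prod_eq_zero (Finset.mem_univ k) (by simp [hb])).symm
    _ = _ := by
        rw [← h, Finset.prod_eq_single k]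
        · simp [ite_not]
        · intro l _ hl
          simp [hl, hp]
        · simp

section Votes

variable {r m : ℕ} (ι : Fin m ≃ {ij : Fin r × Fin r // ij.1 < ij.2})

/-- The hypothesis other than `i` in the pair of block `k`, when that pair involves `i`. -/
def opponent (i : Fin r) (k : Fin m) : Fin r :=
  if (ι k).1.1 = i then (ι k).1.2 else (ι k).1.1

theorem opponent_ne {i : Fin r} (k : Fin m) : opponent ι i k ≠ i := by
  have := (ι k).2
  unfold opponent
  split_ifs with h
  · exact h ▸ this.ne'
  · exact h

theorem opponent_injOn (i : Fin r) :
    Set.InjOn (opponent ι i) {k | (ι k).1.1 = i ∨ (ι k).1.2 = i} := by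
  intro k hk l hl hkl
  apply ι.injective
  have hk' := (ι k).2
  have hl' := (ι l).2
  simp only [Set.mem_ofPred_eq, opponent] at hk hl hkl
  apply Subtype.ext
  apply Prod.ext <;> grind

theorem exists_opponent_eq {i j : Fin r} (hij : j ≠ i) :
    ∃ k, ((ι k).1.1 = i ∨ (ι k).1.2 = i) ∧ opponent ι i k = j := by
  rcases lt_or_gt_of_ne hij with h | h
  · exact ⟨ι.symm ⟨(j, i), h⟩, by simp, by simp [opponent, hij]⟩
  · exact ⟨ι.symm ⟨(i, j), h⟩, by simp, by simp [opponent]⟩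

theorem involves_of_blockVote_eq {b : Fin m → Bool} {k : Fin m} {i : Fin r}
    (h : blockVote ι b k = i) : (ι k).1.1 = i ∨ (ι k).1.2 = i := by
  unfold blockVote at h
  split_ifs at h
  · exact Or.inr h
  · exact Or.inl h

/-- A hypothesis winning all its pairwise comparisons has strictly more votes than any other. -/
theorem voteCount_lt_of_wins_all {b : Fin m → Bool} {i : Fin r}
    (h : ∀ k, ((ι k).1.1 = i ∨ (ι k).1.2 = i) → blockVote ι b k = i) {j : Fin r} (hj : j ≠ i) :
    voteCount ι j b < voteCount ι i b := by
  have hi : (Finset.univ.erase i).card ≤ voteCount ι i b := by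
    refine Finset.card_le_card_of_surjOn (opponent ι i) fun l hl => ?_
    obtain ⟨k, hk, hkl⟩ := exists_opponent_eq ι (Finset.ne_of_mem_erase hl)
    exact ⟨k, by simpa using h k hk, hkl⟩
  have hj' : voteCount ι j b ≤ ((Finset.univ.erase i).erase j).card := by
    refine Finset.card_le_card_of_injOn (opponent ι j) (fun k hk => ?_)
      ((opponent_injOn ι j).mono fun k hk => involves_of_blockVote_eq ι (by simpa using hk))
    have hv : blockVote ι b k = j := by simpa using hk
    have hkj := involves_of_blockVote_eq ι hv
    have hki : ¬((ι k).1.1 = i ∨ (ι k).1.2 = i) := fun hc => hj (hv.symm.trans (h k hc))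
    rw [not_or] at hki
    have hne : opponent ι j k ≠ i := by
      unfold opponent
      split_ifs
      · exact hki.2
      · exact hki.1
    simp [hne, opponent_ne]
  exact (hj'.trans_lt (Finset.card_erase_lt_of_mem (by simp [hj]))).trans_le hi

theorem exists_lost_of_notMem_decisionSet {b : Fin m → Bool} {i : Fin r}
    (hb : b ∉ decisionSet ι i) :
    ∃ k, ((ι k).1.1 = i ∨ (ι k).1.2 = i) ∧ b k = decide ((ι k).1.1 = i) := by
  by_contra! hcon
  apply hb
  have hwin : ∀ k, ((ι k).1.1 = i ∨ (ι k).1.2 = i) → blockVote ι b k = i := by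
    intro k hk
    have hbk := hcon k hk
    have := (ι k).2
    unfold blockVote
    by_cases h1 : (ι k).1.1 = i <;> simp_all
  simp only [decisionSet, Finset.mem_filter, Finset.mem_univ, true_and]
  refine ⟨fun j hj => voteCount_lt_of_wins_all ι hwin hj.ne, fun j _ => ?_⟩
  rcases eq_or_ne j i with rfl | hj
  · exact le_rfl
  · exact (voteCount_lt_of_wins_all ι hwin hj).le

theorem existsUnique_mem_decisionSet [Nonempty (Fin r)] (b : Fin m → Bool) :
    ∃! i, b ∈ decisionSet ι i := by
  simp only [decisionSet, Finset.mem_filter, Finset.mem_univ, true_and]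
  obtain ⟨i, -, hi⟩ := Finset.exists_max_image Finset.univ
    (fun j : Fin r => toLex (voteCount ι j b, OrderDual.toDual j)) Finset.univ_nonempty
  simp only [Prod.Lex.toLex_le_toLex, OrderDual.toDual_le_toDual, Finset.mem_univ,
    forall_const] at hi
  refine ⟨i, ⟨fun j hj => ?_, fun j _ => ?_⟩, ?_⟩
  · exact (hi j).resolve_right fun h => (h.2.trans_lt hj).false
  · exact (hi j).elim le_of_lt fun h => h.1.le
  · rintro j ⟨hlt, hle⟩
    rcases lt_trichotomy j i with h | h | h
    · exact absurd ((hi j).resolve_right fun h' => (h'.2.trans_lt h).false) (hle i h.le).not_gt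
    · exact h
    · have := hlt i h
      rcases hi j with h' | h' <;> omega

theorem sum_sum_decisionSet [Nonempty (Fin r)] {M : Type*} [AddCommMonoid M]
    (f : (Fin m → Bool) → M) : ∑ i, ∑ b ∈ decisionSet ι i, f b = ∑ b, f b := by
  choose w hw hw' using existsUnique_mem_decisionSet ι
  have h : ∀ i, decisionSet ι i = Finset.univ.filter fun b => w b = i := by
    intro i
    ext b
    simp only [Finset.mem_filter, Finset.mem_univ, true_and]
    exact ⟨fun hb => (hw' b i hb).symm, fun hb => hb ▸ hw b⟩
  simp only [h]
  exact Finset.sum_fiberwise _ _ _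

end Votes

/-- The effect of the binary test `T` with outcome `c`. -/
def binaryEffect {n : Type*} [DecidableEq n] (T : Matrix n n ℂ) (c : Bool) : Matrix n n ℂ :=
  if c then 1 - T else T

theorem sum_binaryEffect {n : Type*} [DecidableEq n] (T : Matrix n n ℂ) : ∑ c, binaryEffect T c = 1 := by
  simp [binaryEffect]

theorem posSemidef_binaryEffect {n : Type*} [DecidableEq n] {T : Matrix n n ℂ} (hT : T.PosSemidef)
    (hT' : (1 - T).PosSemidef) (c : Bool) : (binaryEffect T c).PosSemidef := by
  cases c
  · exact hT
  · exact hT'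

theorem sum_tensorFam_binaryEffect {m : ℕ} {D : Fin m → ℕ}
    (T : ∀ k, Matrix (Fin (D k)) (Fin (D k)) ℂ) :
    ∑ b : Fin m → Bool, tensorFam (fun k => binaryEffect (T k) (b k)) = 1 := by
  rw [sum_tensorFam fun k c => binaryEffect (T k) c]
  simp only [sum_binaryEffect, tensorFam_one]

theorem majorityTest_eq_sum_binaryEffect {r m : ℕ} {D : Fin m → ℕ}
    (ι : Fin m ≃ {ij : Fin r × Fin r // ij.1 < ij.2})
    (T : ∀ k, Matrix (Fin (D k)) (Fin (D k)) ℂ) (i : Fin r) :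
    majorityTest ι T i = ∑ b ∈ decisionSet ι i, tensorFam fun k => binaryEffect (T k) (b k) :=
  rfl

/-- **The blockwise majority-vote test and its error estimate (inequality (9)).**
Given binary tests `0 ≤ T k ≤ 1` for the pairs of hypotheses enumerated by the
bijection `ι`, the operators `E_i = majorityTest ι T i` form an `r`-outcome POVM, and
for every product state `σ = ⊗_k σ k` the individual error probability of hypothesis
`i` is bounded by the sum, over the blocks whose pair involves `i`, of the binary
error probabilities of the local tests on the corresponding marginals. -/
theorem majority_vote_test_error_bound (r m : ℕ) (hr : 2 ≤ r)
    (hm : m = r * (r - 1) / 2)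
    (ι : Fin m ≃ {ij : Fin r × Fin r // ij.1 < ij.2})
    (D : Fin m → ℕ) (T : ∀ k, Matrix (Fin (D k)) (Fin (D k)) ℂ)
    (hT : ∀ k, (T k).PosSemidef) (hT' : ∀ k, (1 - T k).PosSemidef) :
    (∀ i, (majorityTest ι T i).PosSemidef) ∧
    (∑ i, majorityTest ι T i) = 1 ∧
    ∀ i : Fin r, ∀ σ : ∀ k, Matrix (Fin (D k)) (Fin (D k)) ℂ,
      (∀ k, (σ k).PosSemidef) → (∀ k, (σ k).trace = 1) →
      (tensorFam σ * (1 - majorityTest ι T i)).trace.re ≤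
        ∑ k ∈ Finset.univ.filter (fun k => (ι k).1.1 = i ∨ (ι k).1.2 = i),
          (σ k * (if (ι k).1.1 = i then 1 - T k else T k)).trace.re := by
  refine ⟨fun i => ?_, ?_, fun i σ hσ hσ1 => ?_⟩
  · rw [majorityTest_eq_sum_binaryEffect]
    exact Matrix.posSemidef_sum _ fun b _ =>
      posSemidef_tensorFam fun k => posSemidef_binaryEffect (hT k) (hT' k) (b k)
  · have : Nonempty (Fin r) := ⟨⟨0, by omega⟩⟩
    simp only [majorityTest_eq_sum_binaryEffect]
    rw [sum_sum_decisionSet, sum_tensorFam_binaryEffect]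
  · set p : Fin m → Bool → ℝ := fun k c => (σ k * binaryEffect (T k) c).trace.re with hp
    have hpC : ∀ k c, (σ k * binaryEffect (T k) c).trace = (p k c : ℂ) := fun k c =>
      Complex.eq_re_of_ofReal_le (r := 0) (by
        simpa using (hσ k).trace_mul_nonneg_s7 (posSemidef_binaryEffect (hT k) (hT' k) c))
    have hp0 : ∀ k c, 0 ≤ p k c := fun k c =>
      (Complex.nonneg_iff.mp
        ((hσ k).trace_mul_nonneg_s7 (posSemidef_binaryEffect (hT k) (hT' k) c))).1
    have hp1 : ∀ k, ∑ c, p k c = 1 := by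
      intro k
      simp only [hp]
      rw [← Complex.re_sum, ← Matrix.trace_sum, ← Matrix.mul_sum, sum_binaryEffect,
        Matrix.mul_one, hσ1, Complex.one_re]
    have hcompl : 1 - majorityTest ι T i =
        ∑ b ∈ (decisionSet ι i)ᶜ, tensorFam fun k => binaryEffect (T k) (b k) := by
      rw [← sum_tensorFam_binaryEffect T, majorityTest_eq_sum_binaryEffect, sub_eq_iff_eq_add,
        Finset.sum_compl_add_sum]
    have hlhs : (tensorFam σ * (1 - majorityTest ι T i)).trace.re =
        ∑ b ∈ (decisionSet ι i)ᶜ, ∏ k, p k (b k) := by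
      rw [hcompl, Matrix.mul_sum, Matrix.trace_sum, Complex.re_sum]
      refine Finset.sum_congr rfl fun b _ => ?_
      rw [tensorFam_mul, trace_tensorFam]
      simp only [hpC]
      rw [← Complex.ofReal_prod, Complex.ofReal_re]
    have hrhs : ∀ k, (σ k * (if (ι k).1.1 = i then 1 - T k else T k)).trace.re =
        ∑ b : Fin m → Bool, if b k = decide ((ι k).1.1 = i) then ∏ l, p l (b l) else 0 := by
      intro k
      rw [← Finset.sum_filter, sum_filter_prod_eq p hp1]
      simp [hp, binaryEffect]
    have hprod : ∀ b : Fin m → Bool, 0 ≤ ∏ k, p k (b k) := fun b =>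
      Finset.prod_nonneg fun k _ => hp0 k (b k)
    simp only [hlhs, hrhs]
    rw [Finset.sum_comm]
    have hterm : ∀ (b : Fin m → Bool) (k : Fin m),
        0 ≤ if b k = decide ((ι k).1.1 = i) then ∏ l, p l (b l) else 0 := fun b k => by
      split_ifs
      exacts [hprod b, le_rfl]
    refine (Finset.sum_le_sum fun b hb => ?_).trans
      (Finset.sum_le_sum_of_subset_of_nonneg (Finset.subset_univ _) fun b _ _ =>
        Finset.sum_nonneg fun k _ => hterm b k)
    obtain ⟨k, hk, hbk⟩ := exists_lost_of_notMem_decisionSet ι (Finset.mem_compl.mp hb)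
    refine le_trans (by rw [if_pos hbk])
      (Finset.single_le_sum (fun k _ => hterm b k) (Finset.mem_filter.mpr ⟨Finset.mem_univ k, hk⟩))
end
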